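/- Let m ≥ 2. (1) There exists a constant C > 0 such that |K⁺(rω, r'ω'; t)| ≤ C·e^{-2α(t)(1-|β(t)|)(r+r')} / |sinh(t/2)|^{m-1} for all r, r' > 0, all ω, ω' ∈ S^{m-1}, and all t ∈ Ω. (2) If Re t > 0, then ∫_{ℝ^m}∫_{ℝ^m} |K⁺(x,x';t)|² |x|^{-1}|x'|^{-1} dx dx' < ∞. -/

import Mathlib

open MeasureTheory
open scoped RealInnerProductSpace

/-- The normalized modified Bessel function
`Ĩ_ν(z) = Σ_{k=0}^∞ (z/2)^{2k}/(k!·Γ(ν+k+1))`. -/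
noncomputable def ItildeC (ν : ℝ) (z : ℂ) : ℂ :=
  ∑' k : ℕ, (z / 2) ^ (2 * k) / ((Nat.factorial k : ℂ) * Complex.Gamma ((ν : ℂ) + k + 1))

/-- The domain `Ω = {t ∈ ℂ : Re t ≥ 0} ∖ 2π√(-1)ℤ`. -/
def InOmega (t : ℂ) : Prop :=
  0 ≤ t.re ∧ ∀ n : ℤ, t ≠ 2 * Real.pi * Complex.I * n

/-- `α(t) = sinh(Re t)/(cosh(Re t) − cos(Im t))`. -/
noncomputable def alphaT (t : ℂ) : ℝ :=
  Real.sinh t.re / (Real.cosh t.re - Real.cos t.im)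

/-- `β(t) = cos(Im t/2)/cosh(Re t/2)`. -/
noncomputable def betaT (t : ℂ) : ℝ :=
  Real.cos (t.im / 2) / Real.cosh (t.re / 2)

/-- `ψ(x,x') = 2√(2(|x||x'| + ⟨x,x'⟩))`. -/
noncomputable def psiK {m : ℕ} (x x' : EuclideanSpace ℝ (Fin m)) : ℝ :=
  2 * Real.sqrt (2 * (‖x‖ * ‖x'‖ + ⟪x, x'⟫))

/-- The kernel `K⁺(x,x';t)`. -/
noncomputable def Kplus (m : ℕ) (t : ℂ) (x x' : EuclideanSpace ℝ (Fin m)) : ℂ :=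
  2 * Complex.exp (-2 * (‖x‖ + ‖x'‖ : ℝ) * (Complex.cosh (t/2) / Complex.sinh (t/2))) *
    ItildeC (((m : ℝ) - 3) / 2) ((psiK x x' : ℝ) / Complex.sinh (t/2)) /
    (((Real.pi ^ (((m : ℝ) - 1) / 2) : ℝ) : ℂ) * (Complex.sinh (t/2)) ^ (m - 1))


lemma gamma_half_fact (k : ℕ) : (Nat.factorial k : ℂ) * Complex.Gamma ((k : ℂ) + 1/2) * 4 ^ k
    = (Nat.factorial (2 * k) : ℂ) * (Real.sqrt Real.pi : ℂ) := by
  induction k with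
  | zero =>
    have := Complex.Gamma_one_half_eq
    rw [← Complex.ofReal_ofNat, ← Complex.ofReal_one, ← Complex.ofReal_div,
      ← Complex.ofReal_cpow Real.pi_pos.le, ← Real.sqrt_eq_rpow] at this
    simp at this
    simp [this]
  | succ k ih =>
    have h : (k : ℂ) + 1/2 ≠ 0 := by
      intro h
      have := congrArg Complex.re h
      simp at this
      have h2 : (0:ℝ) ≤ k := k.cast_nonneg
      norm_num at this
      linarith
    have := Complex.Gamma_add_one _ h
    rw [show ((k + 1 : ℕ) : ℂ) + 1/2 = (k : ℂ) + 1/2 + 1 by push_cast; ring, this]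
    rw [show 2 * (k + 1) = 2 * k + 1 + 1 by ring, Nat.factorial_succ, Nat.factorial_succ,
      Nat.factorial_succ]
    push_cast
    linear_combination (4 * (k + 1) * (k + 1/2)) * ih

lemma norm_cosh_le (z : ℂ) : ‖Complex.cosh z‖ ≤ Real.exp |z.re| := by
  have h1 : ‖Complex.exp z‖ ≤ Real.exp |z.re| := by
    rw [Complex.norm_exp]; exact Real.exp_le_exp.2 (le_abs_self _)
  have h2 : ‖Complex.exp (-z)‖ ≤ Real.exp |z.re| := by
    rw [Complex.norm_exp]; exact Real.exp_le_exp.2 (by simpa using neg_le_abs z.re)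
  rw [Complex.cosh, norm_div]
  have := norm_add_le (Complex.exp z) (Complex.exp (-z))
  simp only [Complex.norm_ofNat]
  linarith

lemma Itilde_term (a : ℝ) (ha : 0 ≤ a) (z : ℂ) (k : ℕ) :
    (z / 2) ^ (2 * k) / ((Nat.factorial k : ℂ) * Complex.Gamma (((a - 1/2 : ℝ) : ℂ) + k + 1))
     = z ^ (2 * k) / (Nat.factorial (2 * k) : ℂ) / (Real.sqrt Real.pi : ℂ) *
      (Complex.Gamma ((k : ℂ) + 1/2) / Complex.Gamma ((k : ℂ) + 1/2 + a)) := by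
  have e : (((a - 1/2 : ℝ) : ℂ) + k + 1) = (k : ℂ) + 1/2 + a := by push_cast; ring
  rw [e]
  have h := gamma_half_fact k
  have h1 : (Nat.factorial k : ℂ) ≠ 0 := by exact_mod_cast k.factorial_ne_zero
  have h2 : (Nat.factorial (2 * k) : ℂ) ≠ 0 := by exact_mod_cast (2 * k).factorial_ne_zero
  have h3 : (Real.sqrt Real.pi : ℂ) ≠ 0 := by
    exact_mod_cast (Real.sqrt_pos.2 Real.pi_pos).ne'
  have h4 : Complex.Gamma ((k : ℂ) + 1/2 + a) ≠ 0 := by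
    apply Complex.Gamma_ne_zero_of_re_pos
    have : (0:ℝ) ≤ k := k.cast_nonneg
    simp; norm_num; linarith
  generalize Complex.Gamma ((k : ℂ) + 1/2 + a) = G at h4 ⊢
  generalize Complex.Gamma ((k : ℂ) + 1/2) = G' at h ⊢
  rw [div_pow, pow_mul 2 2 k, show (2 : ℂ) ^ 2 = 4 by norm_num, div_div, div_div,
    div_mul_div_comm, div_eq_div_iff (mul_ne_zero (by norm_num) (mul_ne_zero h1 h4))
      (mul_ne_zero (mul_ne_zero h2 h3) h4)]
  linear_combination (-z ^ (2 * k) * G) * h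

lemma Itilde_bound (a : ℝ) (ha : 0 ≤ a) :
    ∃ C : ℝ, 0 < C ∧ ∀ z : ℂ, ‖ItildeC (a - 1/2) z‖ ≤ C * Real.exp |z.re| := by
  have hpi : 0 < Real.sqrt Real.pi := Real.sqrt_pos.2 Real.pi_pos
  rcases ha.eq_or_lt with rfl | hpos
  · refine ⟨1 / Real.sqrt Real.pi, by positivity, fun z => ?_⟩
    unfold ItildeC
    have : ∀ k : ℕ, Complex.Gamma ((k : ℂ) + 1/2) ≠ 0 := by
      intro k
      apply Complex.Gamma_ne_zero_of_re_pos
      have : (0:ℝ) ≤ k := k.cast_nonneg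
      simp; norm_num; linarith
    simp_rw [Itilde_term 0 le_rfl z]
    simp only [Complex.ofReal_zero, add_zero, div_self (this _), mul_one]
    rw [((Complex.hasSum_cosh z).div_const _).tsum_eq, norm_div, Complex.norm_real,
      Real.norm_of_nonneg hpi.le, div_eq_mul_inv, mul_comm, ← one_div]
    gcongr
    exact norm_cosh_le z
  · set w : ℝ → ℂ := fun u => (u : ℂ) ^ ((1/2 : ℂ) - 1) * (1 - (u : ℂ)) ^ ((a : ℂ) - 1) with hw
    have hwint : IntervalIntegrable w volume 0 1 :=
      Complex.betaIntegral_convergent (by norm_num) (by simpa using hpos)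
    have hGa : 0 < Real.Gamma a := Real.Gamma_pos_of_pos hpos
    have hnn : 0 ≤ ∫ u in (0:ℝ)..1, ‖w u‖ :=
      intervalIntegral.integral_nonneg zero_le_one (fun _ _ => norm_nonneg _)
    refine ⟨1 / (Real.sqrt Real.pi * Real.Gamma a) * ((∫ u in (0:ℝ)..1, ‖w u‖) + 1),
      by positivity, fun z => ?_⟩
    have hF : ∀ (k : ℕ), ∀ u ∈ Set.Ioc (0:ℝ) 1,
        z ^ (2 * k) / (Nat.factorial (2 * k) : ℂ) *
          ((u : ℂ) ^ ((k : ℂ) + 1/2 - 1) * (1 - (u : ℂ)) ^ ((a : ℂ) - 1))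
        = (z * (Real.sqrt u : ℂ)) ^ (2 * k) / (Nat.factorial (2 * k) : ℂ) * w u := by
      intro k u hu
      have hu0 : (u : ℂ) ≠ 0 := by exact_mod_cast hu.1.ne'
      rw [hw, show (k : ℂ) + 1/2 - 1 = k + (1/2 - 1) by ring, Complex.cpow_add _ _ hu0,
        Complex.cpow_natCast, mul_pow, pow_mul (Real.sqrt u : ℂ) 2 k,
        ← Complex.ofReal_pow (Real.sqrt u), Real.sq_sqrt hu.1.le]
      ring
    have hsum : HasSum (fun k : ℕ => ∫ u in (0:ℝ)..1,
        (z * (Real.sqrt u : ℂ)) ^ (2 * k) / (Nat.factorial (2 * k) : ℂ) * w u)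
        (∫ u in (0:ℝ)..1, Complex.cosh (z * (Real.sqrt u : ℂ)) * w u) := by
      apply intervalIntegral.hasSum_integral_of_dominated_convergence
        (fun k u => ‖z‖ ^ (2 * k) / (Nat.factorial (2 * k) : ℝ) * ‖w u‖)
      · intro k
        refine AEStronglyMeasurable.mul ?_ hwint.def'.aestronglyMeasurable
        exact Continuous.aestronglyMeasurable (by fun_prop)
      · intro k
        filter_upwards with u hu
        rw [Set.uIoc_of_le zero_le_one] at hu
        rw [norm_mul, norm_div, norm_pow, norm_mul, Complex.norm_real, Complex.norm_natCast,
          Real.norm_of_nonneg (Real.sqrt_nonneg _)]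
        gcongr
        exact mul_le_of_le_one_right (norm_nonneg _) (Real.sqrt_le_one.2 hu.2)
      · filter_upwards with u hu
        exact ((Real.hasSum_cosh ‖z‖).summable).mul_right _
      · simp_rw [tsum_mul_right]
        exact hwint.norm.const_mul _
      · filter_upwards with u hu
        exact (Complex.hasSum_cosh _).mul_right _
    have hI : ItildeC (a - 1/2) z = 1 / ((Real.sqrt Real.pi : ℂ) * (Real.Gamma a : ℂ)) *
        ∫ u in (0:ℝ)..1, Complex.cosh (z * (Real.sqrt u : ℂ)) * w u := by
      unfold ItildeC
      rw [← (hsum.mul_left _).tsum_eq]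
      congr 1
      ext k
      rw [Itilde_term a ha z]
      have hk : (0:ℝ) < ((k : ℂ) + 1/2).re := by
        have : (0:ℝ) ≤ k := k.cast_nonneg
        simp; norm_num; linarith
      have hb := Complex.Gamma_mul_Gamma_eq_betaIntegral (s := (k : ℂ) + 1/2) (t := a) hk
        (by simpa using hpos)
      have h4 : Complex.Gamma ((k : ℂ) + 1/2 + a) ≠ 0 := by
        apply Complex.Gamma_ne_zero_of_re_pos
        rw [Complex.add_re, Complex.ofReal_re]; linarith
      have h5 : (Real.Gamma a : ℂ) ≠ 0 := by exact_mod_cast hGa.ne'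
      rw [Complex.Gamma_ofReal] at hb
      have hb' : Complex.Gamma ((k : ℂ) + 1/2) / Complex.Gamma ((k : ℂ) + 1/2 + a)
          = Complex.betaIntegral ((k : ℂ) + 1/2) a / (Real.Gamma a : ℂ) := by
        rw [div_eq_div_iff h4 h5, hb]; ring
      rw [hb']
      have : ∫ u in (0:ℝ)..1,
          (z * (Real.sqrt u : ℂ)) ^ (2 * k) / (Nat.factorial (2 * k) : ℂ) * w u
          = z ^ (2 * k) / (Nat.factorial (2 * k) : ℂ) *
            Complex.betaIntegral ((k : ℂ) + 1/2) a := by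
        rw [Complex.betaIntegral, ← intervalIntegral.integral_const_mul]
        refine intervalIntegral.integral_congr_ae ?_
        filter_upwards with u hu
        rw [Set.uIoc_of_le zero_le_one] at hu
        exact (hF k u hu).symm
      rw [this]
      field_simp
    rw [hI, norm_mul, norm_div, norm_mul, Complex.norm_real, Complex.norm_real, norm_one,
      Real.norm_of_nonneg hpi.le, Real.norm_of_nonneg hGa.le, mul_assoc]
    gcongr
    calc ‖∫ u in (0:ℝ)..1, Complex.cosh (z * (Real.sqrt u : ℂ)) * w u‖
        ≤ ∫ u in (0:ℝ)..1, ‖w u‖ * Real.exp |z.re| := by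
          apply intervalIntegral.norm_integral_le_of_norm_le zero_le_one
          · filter_upwards with u hu
            rw [norm_mul, mul_comm]
            gcongr
            refine (norm_cosh_le _).trans ?_
            rw [Complex.re_mul_ofReal, abs_mul, abs_of_nonneg (Real.sqrt_nonneg u)]
            exact Real.exp_le_exp.2
              (mul_le_of_le_one_right (abs_nonneg _) (Real.sqrt_le_one.2 hu.2))
          · exact hwint.norm.mul_const _
      _ = (∫ u in (0:ℝ)..1, ‖w u‖) * Real.exp |z.re| := intervalIntegral.integral_mul_const _ _
      _ ≤ _ := by gcongr; linarith

lemma sinh_half_re (t : ℂ) : (Complex.sinh (t/2)).re = Real.sinh (t.re/2) * Real.cos (t.im/2) := by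
  have : t/2 = ((t.re/2 : ℝ) : ℂ) + ((t.im/2 : ℝ) : ℂ) * Complex.I := by
    apply Complex.ext <;> simp
  rw [this, Complex.sinh_add, Complex.cosh_mul_I, Complex.sinh_mul_I, ← Complex.ofReal_sinh,
    ← Complex.ofReal_cosh, ← Complex.ofReal_sin, ← Complex.ofReal_cos]
  simp only [Complex.add_re, Complex.add_im, Complex.mul_re, Complex.mul_im, Complex.ofReal_re,
    Complex.ofReal_im, Complex.I_re, Complex.I_im]
  ring

lemma sinh_half_im (t : ℂ) : (Complex.sinh (t/2)).im = Real.cosh (t.re/2) * Real.sin (t.im/2) := by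
  have : t/2 = ((t.re/2 : ℝ) : ℂ) + ((t.im/2 : ℝ) : ℂ) * Complex.I := by
    apply Complex.ext <;> simp
  rw [this, Complex.sinh_add, Complex.cosh_mul_I, Complex.sinh_mul_I, ← Complex.ofReal_sinh,
    ← Complex.ofReal_cosh, ← Complex.ofReal_sin, ← Complex.ofReal_cos]
  simp only [Complex.add_re, Complex.add_im, Complex.mul_re, Complex.mul_im, Complex.ofReal_re,
    Complex.ofReal_im, Complex.I_re, Complex.I_im]
  ring

lemma cosh_half_re (t : ℂ) : (Complex.cosh (t/2)).re = Real.cosh (t.re/2) * Real.cos (t.im/2) := by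
  have : t/2 = ((t.re/2 : ℝ) : ℂ) + ((t.im/2 : ℝ) : ℂ) * Complex.I := by
    apply Complex.ext <;> simp
  rw [this, Complex.cosh_add, Complex.cosh_mul_I, Complex.sinh_mul_I, ← Complex.ofReal_sinh,
    ← Complex.ofReal_cosh, ← Complex.ofReal_sin, ← Complex.ofReal_cos]
  simp only [Complex.add_re, Complex.add_im, Complex.mul_re, Complex.mul_im, Complex.ofReal_re,
    Complex.ofReal_im, Complex.I_re, Complex.I_im]
  ring

lemma cosh_half_im (t : ℂ) : (Complex.cosh (t/2)).im = Real.sinh (t.re/2) * Real.sin (t.im/2) := by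
  have : t/2 = ((t.re/2 : ℝ) : ℂ) + ((t.im/2 : ℝ) : ℂ) * Complex.I := by
    apply Complex.ext <;> simp
  rw [this, Complex.cosh_add, Complex.cosh_mul_I, Complex.sinh_mul_I, ← Complex.ofReal_sinh,
    ← Complex.ofReal_cosh, ← Complex.ofReal_sin, ← Complex.ofReal_cos]
  simp only [Complex.add_re, Complex.add_im, Complex.mul_re, Complex.mul_im, Complex.ofReal_re,
    Complex.ofReal_im, Complex.I_re, Complex.I_im]
  ring

lemma den_eq (t : ℂ) : Real.cosh t.re - Real.cos t.im = 2 * Complex.normSq (Complex.sinh (t/2)) := by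
  rw [Complex.normSq_apply, sinh_half_re, sinh_half_im]
  have h1 := Real.cosh_two_mul (t.re/2)
  have h2 := Real.cos_two_mul (t.im/2)
  have h3 := Real.cosh_sq (t.re/2)
  have h4 := Real.sin_sq_add_cos_sq (t.im/2)
  rw [mul_div_cancel₀ _ two_ne_zero] at h1 h2
  rw [h1, h2]
  linear_combination (2 * Real.cos (t.im/2) ^ 2 - 1) * h3 - 2 * Real.cosh (t.re/2) ^ 2 * h4

lemma coth_re (t : ℂ) : (Complex.cosh (t/2) / Complex.sinh (t/2)).re = alphaT t := by
  rw [Complex.div_re, sinh_half_re, sinh_half_im, cosh_half_re, cosh_half_im, alphaT, den_eq]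
  have h1 := Real.sinh_two_mul (t.re/2)
  rw [mul_div_cancel₀ _ two_ne_zero] at h1
  have h4 := Real.sin_sq_add_cos_sq (t.im/2)
  rw [h1, ← add_div, mul_assoc 2, mul_div_mul_left _ _ two_ne_zero]
  congr 1
  linear_combination (Real.sinh (t.re/2) * Real.cosh (t.re/2)) * h4

lemma inv_sinh_re (t : ℂ) : ((Complex.sinh (t/2))⁻¹).re = alphaT t * betaT t := by
  rw [Complex.inv_re, sinh_half_re, alphaT, betaT, den_eq]
  have h1 := Real.sinh_two_mul (t.re/2)
  rw [mul_div_cancel₀ _ two_ne_zero] at h1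
  rw [h1, mul_assoc 2, mul_div_mul_left _ _ two_ne_zero]
  have := (Real.cosh_pos (t.re/2)).ne'
  rw [div_mul_div_comm]
  field_simp

lemma alphaT_nonneg (t : ℂ) (ht : 0 ≤ t.re) : 0 ≤ alphaT t := by
  rw [alphaT, den_eq]
  exact div_nonneg (Real.sinh_nonneg_iff.2 ht) (by have := Complex.normSq_nonneg (Complex.sinh (t/2)); linarith)

lemma psiK_le {m : ℕ} (x x' : EuclideanSpace ℝ (Fin m)) : psiK x x' ≤ 2 * (‖x‖ + ‖x'‖) := by
  unfold psiK
  gcongr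
  apply Real.sqrt_le_iff.2 ⟨by positivity, ?_⟩
  have := real_inner_le_norm x x'
  nlinarith [sq_nonneg (‖x‖ - ‖x'‖)]

lemma psiK_nonneg {m : ℕ} (x x' : EuclideanSpace ℝ (Fin m)) : 0 ≤ psiK x x' := by
  unfold psiK; positivity

lemma Kplus_bound (H : ∀ (a : ℝ), 0 ≤ a →
    ∃ C : ℝ, 0 < C ∧ ∀ z : ℂ, ‖ItildeC (a - 1/2) z‖ ≤ C * Real.exp |z.re|) (m : ℕ) (hm : 2 ≤ m) :
    ∃ C : ℝ, 0 < C ∧ ∀ (x x' : EuclideanSpace ℝ (Fin m)) (t : ℂ), 0 ≤ t.re →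
        ‖Kplus m t x x'‖ ≤
          C * Real.exp (-2 * alphaT t * (1 - |betaT t|) * (‖x‖ + ‖x'‖)) /
            ‖Complex.sinh (t/2)‖ ^ (m - 1) := by
  have hm' : (2:ℝ) ≤ m := by exact_mod_cast hm
  obtain ⟨C, hC, hb⟩ := H (((m:ℝ) - 2)/2) (by linarith)
  rw [show ((m:ℝ) - 2)/2 - 1/2 = ((m:ℝ) - 3)/2 by ring] at hb
  have hp : 0 < Real.pi ^ (((m : ℝ) - 1) / 2) := Real.rpow_pos_of_pos Real.pi_pos _
  refine ⟨2 * C / Real.pi ^ (((m : ℝ) - 1) / 2), by positivity, fun x x' t ht => ?_⟩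
  have ha := alphaT_nonneg t ht
  unfold Kplus
  rw [norm_div, norm_mul, norm_mul, norm_mul, norm_pow, Complex.norm_real,
    Real.norm_of_nonneg hp.le, Complex.norm_ofNat, Complex.norm_exp]
  have e1 : (-2 * ((‖x‖ + ‖x'‖ : ℝ) : ℂ) * (Complex.cosh (t/2) / Complex.sinh (t/2))).re
      = -2 * (‖x‖ + ‖x'‖) * alphaT t := by
    rw [← coth_re, show (-2 * ((‖x‖ + ‖x'‖ : ℝ) : ℂ)) = ((-2 * (‖x‖ + ‖x'‖) : ℝ) : ℂ) by push_cast; ring,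
      Complex.re_ofReal_mul]
  have e2 : |((psiK x x' : ℂ) / Complex.sinh (t/2)).re| ≤ 2 * (‖x‖ + ‖x'‖) * (alphaT t * |betaT t|) := by
    rw [div_eq_mul_inv, Complex.re_ofReal_mul, inv_sinh_re, abs_mul, abs_mul, abs_of_nonneg ha,
      abs_of_nonneg (psiK_nonneg x x')]
    gcongr
    exact psiK_le x x'
  have e3 := (hb ((psiK x x' : ℂ) / Complex.sinh (t/2))).trans
    (mul_le_mul_of_nonneg_left (Real.exp_le_exp.2 e2) hC.le)
  rw [e1]
  calc _ ≤ 2 * Real.exp (-2 * (‖x‖ + ‖x'‖) * alphaT t) *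
        (C * Real.exp (2 * (‖x‖ + ‖x'‖) * (alphaT t * |betaT t|))) /
        (Real.pi ^ (((m : ℝ) - 1) / 2) * ‖Complex.sinh (t/2)‖ ^ (m - 1)) := by gcongr
    _ = _ := by
      rw [show -2 * alphaT t * (1 - |betaT t|) * (‖x‖ + ‖x'‖) = -2 * (‖x‖ + ‖x'‖) * alphaT t +
        2 * (‖x‖ + ‖x'‖) * (alphaT t * |betaT t|) by ring, Real.exp_add, ← div_div]
      ring

lemma radial_integrable (m : ℕ) (hm : 2 ≤ m) (c : ℝ) (hc : 0 < c) :
    Integrable (fun x : EuclideanSpace ℝ (Fin m) => Real.exp (-c * ‖x‖) * ‖x‖⁻¹) := by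
  have : Nonempty (Fin m) := ⟨⟨0, by omega⟩⟩
  have := (integrable_fun_norm_addHaar (E := EuclideanSpace ℝ (Fin m)) volume
    (f := fun r : ℝ => Real.exp (-c * r) * r⁻¹)).2 ?_
  · exact this
  have h := integrableOn_rpow_mul_exp_neg_mul_rpow (p := 1) (s := ((m - 2 : ℕ) : ℝ)) (b := c)
    (by have : (0:ℝ) ≤ (m - 2 : ℕ) := Nat.cast_nonneg _
        linarith) one_pos hc
  refine h.congr_fun (fun r hr => ?_) measurableSet_Ioi
  have hr : r ≠ 0 := (Set.mem_Ioi.1 hr).ne'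
  obtain ⟨n, rfl⟩ := Nat.exists_eq_add_of_le hm
  simp only [finrank_euclideanSpace, Fintype.card_fin, smul_eq_mul, Real.rpow_natCast, Real.rpow_one]
  rw [show 2 + n - 1 = n + 1 by omega, show 2 + n - 2 = n by omega, pow_succ]
  field_simp

theorem Kplus_main_aux (H : ∀ (a : ℝ), 0 ≤ a →
    ∃ C : ℝ, 0 < C ∧ ∀ z : ℂ, ‖ItildeC (a - 1/2) z‖ ≤ C * Real.exp |z.re|) (m : ℕ) (hm : 2 ≤ m) :
    (∃ C : ℝ, 0 < C ∧ ∀ r r' : ℝ, 0 < r → 0 < r' →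
      ∀ ω ω' : Metric.sphere (0 : EuclideanSpace ℝ (Fin m)) 1, ∀ t : ℂ, InOmega t →
        ‖Kplus m t (r • (ω : EuclideanSpace ℝ (Fin m)))
            (r' • (ω' : EuclideanSpace ℝ (Fin m)))‖ ≤
          C * Real.exp (-2 * alphaT t * (1 - |betaT t|) * (r + r')) /
            ‖Complex.sinh (t/2)‖ ^ (m - 1)) ∧
    (∀ t : ℂ, 0 < t.re →
      ∫⁻ x : EuclideanSpace ℝ (Fin m), ∫⁻ x' : EuclideanSpace ℝ (Fin m),
        ENNReal.ofReal (‖Kplus m t x x'‖ ^ 2 * ‖x‖⁻¹ * ‖x'‖⁻¹) < ⊤) := by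
  obtain ⟨C, hC, hK⟩ := Kplus_bound H m hm
  refine ⟨⟨C, hC, fun r r' hr hr' ω ω' t ht => ?_⟩, fun t ht => ?_⟩
  · have := hK (r • (ω : EuclideanSpace ℝ (Fin m))) (r' • (ω' : EuclideanSpace ℝ (Fin m))) t ht.1
    rw [norm_smul, norm_smul, norm_eq_of_mem_sphere ω, norm_eq_of_mem_sphere ω', mul_one, mul_one,
      Real.norm_of_nonneg hr.le, Real.norm_of_nonneg hr'.le] at this
    exact this
  · set D : ℝ := C / ‖Complex.sinh (t/2)‖ ^ (m - 1) with hD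
    have hD0 : 0 ≤ D := by positivity
    set c : ℝ := 4 * alphaT t * (1 - |betaT t|) with hc
    have hb : |betaT t| < 1 := by
      rw [betaT, abs_div, abs_of_pos (Real.cosh_pos _), div_lt_one (Real.cosh_pos _)]
      exact (Real.abs_cos_le_one _).trans_lt (Real.one_lt_cosh.2 (by positivity))
    have ha : 0 < alphaT t := by
      have h1 : 1 < Real.cosh t.re := Real.one_lt_cosh.2 ht.ne'
      have h2 := Real.cos_le_one t.im
      exact div_pos (Real.sinh_pos_iff.2 ht) (by linarith)
    have hc0 : 0 < c := mul_pos (by linarith) (by linarith)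
    set g : EuclideanSpace ℝ (Fin m) → ℝ := fun x => Real.exp (-c * ‖x‖) * ‖x‖⁻¹ with hg
    have hg0 : ∀ x, 0 ≤ g x := fun x => by positivity
    have hgi : Integrable g := radial_integrable m hm c hc0
    have hfin : ∫⁻ x, ENNReal.ofReal (g x) < ⊤ := hgi.lintegral_lt_top
    have hle : ∀ x x', ENNReal.ofReal (‖Kplus m t x x'‖ ^ 2 * ‖x‖⁻¹ * ‖x'‖⁻¹) ≤
        ENNReal.ofReal (D ^ 2) * ENNReal.ofReal (g x) * ENNReal.ofReal (g x') := by
      intro x x'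
      rw [← ENNReal.ofReal_mul (by positivity), ← ENNReal.ofReal_mul (mul_nonneg (by positivity) (hg0 x))]
      apply ENNReal.ofReal_le_ofReal
      calc ‖Kplus m t x x'‖ ^ 2 * ‖x‖⁻¹ * ‖x'‖⁻¹ ≤
          (C * Real.exp (-2 * alphaT t * (1 - |betaT t|) * (‖x‖ + ‖x'‖)) /
            ‖Complex.sinh (t/2)‖ ^ (m - 1)) ^ 2 * ‖x‖⁻¹ * ‖x'‖⁻¹ := by
            gcongr
            exact hK x x' t ht.le
        _ = D ^ 2 * g x * g x' := by
            have : Real.exp (-2 * alphaT t * (1 - |betaT t|) * (‖x‖ + ‖x'‖)) ^ 2 =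
              Real.exp (-c * ‖x‖) * Real.exp (-c * ‖x'‖) := by
              rw [← Real.exp_add, ← Real.exp_nat_mul]
              congr 1
              rw [hc]; push_cast; ring
            rw [div_pow, mul_pow, this, hD, hg]
            ring
    calc _ ≤ ∫⁻ x, ∫⁻ x', ENNReal.ofReal (D ^ 2) * ENNReal.ofReal (g x) * ENNReal.ofReal (g x') :=
          lintegral_mono fun x => lintegral_mono fun x' => hle x x'
      _ = ENNReal.ofReal (D ^ 2) * (∫⁻ x, ENNReal.ofReal (g x)) * ∫⁻ x, ENNReal.ofReal (g x) := by
          have hm1 : AEMeasurable (fun x => ENNReal.ofReal (g x)) :=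
            hgi.aestronglyMeasurable.aemeasurable.ennreal_ofReal
          simp_rw [lintegral_const_mul'' _ hm1]
          rw [lintegral_mul_const' _ _ hfin.ne, lintegral_const_mul'' _ hm1]
      _ < ⊤ := ENNReal.mul_lt_top (ENNReal.mul_lt_top ENNReal.ofReal_lt_top hfin) hfin

/-- Upper estimate and square-integrability of the kernel `K⁺`. -/
theorem Kplus_bound_and_sq_integrable (m : ℕ) (hm : 2 ≤ m) :
    (∃ C : ℝ, 0 < C ∧ ∀ r r' : ℝ, 0 < r → 0 < r' →
      ∀ ω ω' : Metric.sphere (0 : EuclideanSpace ℝ (Fin m)) 1, ∀ t : ℂ, InOmega t →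
        ‖Kplus m t (r • (ω : EuclideanSpace ℝ (Fin m)))
            (r' • (ω' : EuclideanSpace ℝ (Fin m)))‖ ≤
          C * Real.exp (-2 * alphaT t * (1 - |betaT t|) * (r + r')) /
            ‖Complex.sinh (t/2)‖ ^ (m - 1)) ∧
    (∀ t : ℂ, 0 < t.re →
      ∫⁻ x : EuclideanSpace ℝ (Fin m), ∫⁻ x' : EuclideanSpace ℝ (Fin m),
        ENNReal.ofReal (‖Kplus m t x x'‖ ^ 2 * ‖x‖⁻¹ * ‖x'‖⁻¹) < ⊤) := by
  exact Kplus_main_aux Itilde_bound m hm
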